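/- Let κ > 0 and let the cost c be a continuous non-negative function on T×T satisfying c(θ,φ) = 0 iff θ = φ, and c(θ,φ) = c(φ,θ) (i.e., a semi-metric). Then T_κ(R₀,R₁), defined as the minimum of S_κ(Φ₀,Φ₁) over all non-negative measures Φ₀, Φ₁ consistent with R₀ and R₁ respectively, is a semi-metric on the set of positive semi-definite Toeplitz matrices: T_κ ≥ 0, T_κ is symmetric, and T_κ(R₀,R₁) = 0 if and only if R₀ = R₁. -/

import Mathlib

open MeasureTheory Matrix
open scoped ENNReal ComplexOrder

/-- The circle `T = (-π, π]`, modeled as `ℝ / 2πℤ`. -/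
abbrev Tcircle := AddCircle (2 * Real.pi)

/-- The optimal mass transport cost `S(Φ₀, Φ₁)` with cost function `c`: the infimum of
`∫∫ c dM` over all transport plans `M` (non-negative measures on `T × T`) whose marginals
are `Φ₀` and `Φ₁`.  (It equals `∞` when no transport plan exists, e.g. when the total
masses differ.) -/
noncomputable def otCost (c : Tcircle → Tcircle → ℝ) (Φ₀ Φ₁ : Measure Tcircle) : ℝ≥0∞ :=
  sInf { x | ∃ M : Measure (Tcircle × Tcircle),
      M.map Prod.fst = Φ₀ ∧ M.map Prod.snd = Φ₁ ∧
      x = ∫⁻ p, ENNReal.ofReal (c p.1 p.2) ∂M }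

/-- The Fourier vector `a(θ) = (1, e^{iθ}, ..., e^{i(n-1)θ})` on the circle. -/
noncomputable def aVecC (n : ℕ) (θ : Tcircle) : Fin n → ℂ :=
  fun k => fourier (k : ℤ) θ

/-- `Γ(Φ) = (1/2π) ∫ a(θ) a(θ)ᴴ dΦ(θ)`, entrywise `Γ(Φ)_{jk} = (1/2π) ∫ e^{i(j-k)θ} dΦ`. -/
noncomputable def GammaC (n : ℕ) (μ : Measure Tcircle) : Matrix (Fin n) (Fin n) ℂ :=
  Matrix.of fun j k : Fin n =>
    ((1 / (2 * Real.pi) : ℝ) : ℂ) * ∫ θ, fourier ((j : ℤ) - (k : ℤ)) θ ∂μ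

/-- A matrix is Toeplitz if its entries depend only on the difference of the indices. -/
def IsToeplitz {n : ℕ} (R : Matrix (Fin n) (Fin n) ℂ) : Prop :=
  ∀ j k j' k' : Fin n, (j : ℤ) - (k : ℤ) = (j' : ℤ) - (k' : ℤ) → R j k = R j' k'

/-- Total variation norm `‖μ - ν‖₁` of the difference of two (non-negative) measures. -/
noncomputable def tvDist (μ ν : Measure Tcircle) : ℝ≥0∞ :=
  (μ - ν) Set.univ + (ν - μ) Set.univ

/-- `S_κ` with a general cost function `c`. -/
noncomputable def SkappaC (c : Tcircle → Tcircle → ℝ) (κ : ℝ)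
    (Φ₀ Φ₁ : Measure Tcircle) : ℝ≥0∞ :=
  ⨅ (Ψ₀ : Measure Tcircle) (Ψ₁ : Measure Tcircle),
    otCost c Ψ₀ Ψ₁ + ENNReal.ofReal κ * (tvDist Φ₀ Ψ₀ + tvDist Φ₁ Ψ₁)

/-- `T_κ(R₀,R₁)`: the infimum of `S_κ(Φ₀,Φ₁)` over all non-negative (bounded) measures
consistent with `R₀` and `R₁` respectively. -/
noncomputable def Tkappa (n : ℕ) (c : Tcircle → Tcircle → ℝ) (κ : ℝ)
    (R₀ R₁ : Matrix (Fin n) (Fin n) ℂ) : ℝ≥0∞ :=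
  ⨅ (Φ₀ : {Φ : Measure Tcircle // IsFiniteMeasure Φ ∧ GammaC n Φ = R₀})
    (Φ₁ : {Φ : Measure Tcircle // IsFiniteMeasure Φ ∧ GammaC n Φ = R₁}),
    SkappaC c κ (Φ₀ : Measure Tcircle) (Φ₁ : Measure Tcircle)

/-! ### Total variation -/

theorem MeasureTheory.Measure.sub_add_eq_sup {α : Type*} [MeasurableSpace α] (μ ν : Measure α)
    [IsFiniteMeasure ν] : μ - ν + ν = μ ⊔ ν := by
  have h : μ - ν = (μ ⊔ ν) - ν := by
    rw [Measure.sub_def, Measure.sub_def]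
    congr 1
    ext d
    exact ⟨fun h => sup_le h (Measure.le_add_left le_rfl), fun h => (le_sup_left (b := ν)).trans h⟩
  rw [h, Measure.sub_add_cancel_of_le le_sup_right]

theorem isFiniteMeasure_of_tvDist_ne_top {μ ν : Measure Tcircle} [IsFiniteMeasure μ]
    (h : tvDist μ ν ≠ ∞) : IsFiniteMeasure ν := by
  have hle : ν ≤ ν - μ + μ := by
    rw [Measure.sub_add_eq_sup]
    exact le_sup_left
  refine ⟨(hle Set.univ).trans_lt ?_⟩
  rw [Measure.add_apply]
  exact ENNReal.add_lt_top.2 ⟨(ENNReal.add_ne_top.1 h).2.lt_top, measure_lt_top _ _⟩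

theorem norm_integral_sub_integral_le_tvDist {μ ν : Measure Tcircle} [IsFiniteMeasure μ]
    [IsFiniteMeasure ν] (f : C(Tcircle, ℂ)) (hf : ∀ x, ‖f x‖ ≤ 1) :
    ‖∫ x, f x ∂μ - ∫ x, f x ∂ν‖ ≤ (tvDist μ ν).toReal := by
  have hfi (ρ : Measure Tcircle) [IsFiniteMeasure ρ] : Integrable f ρ :=
    Integrable.of_bound f.continuous.aestronglyMeasurable 1 (Filter.Eventually.of_forall hf)
  have hbd (ρ : Measure Tcircle) [IsFiniteMeasure ρ] : ‖∫ x, f x ∂ρ‖ ≤ ρ.real Set.univ := by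
    simpa using norm_integral_le_of_norm_le_const (μ := ρ) (Filter.Eventually.of_forall hf)
  have hsum : μ - ν + ν = ν - μ + μ := by
    rw [Measure.sub_add_eq_sup, Measure.sub_add_eq_sup, sup_comm]
  have h := congrArg (fun ρ : Measure Tcircle => ∫ x, f x ∂ρ) hsum
  simp only [integral_add_measure (hfi _) (hfi _)] at h
  have h' : ∫ x, f x ∂μ - ∫ x, f x ∂ν = ∫ x, f x ∂(μ - ν) - ∫ x, f x ∂(ν - μ) := by
    linear_combination -h
  rw [h', tvDist, ENNReal.toReal_add (measure_ne_top _ _) (measure_ne_top _ _)]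
  exact (norm_sub_le _ _).trans (add_le_add (hbd _) (hbd _))

theorem tvDist_self (μ : Measure Tcircle) : tvDist μ μ = 0 := by
  simp [tvDist]

/-! ### Transport cost -/

theorem otCost_comm {c : Tcircle → Tcircle → ℝ} (hc : ∀ θ φ, c θ φ = c φ θ)
    (Φ₀ Φ₁ : Measure Tcircle) : otCost c Φ₀ Φ₁ = otCost c Φ₁ Φ₀ := by
  have key (Φ₀ Φ₁ : Measure Tcircle) : otCost c Φ₀ Φ₁ ≤ otCost c Φ₁ Φ₀ := by
    refine le_sInf ?_
    rintro x ⟨M, h₁, h₀, rfl⟩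
    refine sInf_le ⟨M.map Prod.swap, ?_, ?_, ?_⟩
    · rw [Measure.map_map measurable_fst measurable_swap]
      exact h₀
    · rw [Measure.map_map measurable_snd measurable_swap]
      exact h₁
    · change _ = ∫⁻ p, _ ∂(M.map MeasurableEquiv.prodComm)
      rw [lintegral_map_equiv]
      exact lintegral_congr fun p => congrArg _ (hc _ _)
  exact le_antisymm (key _ _) (key _ _)

theorem otCost_self {c : Tcircle → Tcircle → ℝ}
    (hcont : Continuous fun p : Tcircle × Tcircle => c p.1 p.2)
    (hc : ∀ θ, c θ θ = 0) (Φ : Measure Tcircle) : otCost c Φ Φ = 0 := by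
  have hd : Measurable fun θ : Tcircle => (θ, θ) := measurable_id.prodMk measurable_id
  refine nonpos_iff_eq_zero.1 (sInf_le ⟨Φ.map fun θ => (θ, θ), ?_, ?_, ?_⟩)
  · rw [Measure.map_map measurable_fst hd]
    exact Measure.map_id
  · rw [Measure.map_map measurable_snd hd]
    exact Measure.map_id
  · rw [lintegral_map hcont.measurable.ennreal_ofReal hd]
    simp [hc]

theorem SkappaC_comm {c : Tcircle → Tcircle → ℝ} (hc : ∀ θ φ, c θ φ = c φ θ) (κ : ℝ)
    (Φ₀ Φ₁ : Measure Tcircle) : SkappaC c κ Φ₀ Φ₁ = SkappaC c κ Φ₁ Φ₀ := by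
  unfold SkappaC
  rw [iInf_comm]
  refine iInf_congr fun Ψ₁ => iInf_congr fun Ψ₀ => ?_
  rw [otCost_comm hc, add_comm (tvDist Φ₀ Ψ₀)]

theorem SkappaC_self {c : Tcircle → Tcircle → ℝ}
    (hcont : Continuous fun p : Tcircle × Tcircle => c p.1 p.2)
    (hc : ∀ θ, c θ θ = 0) (κ : ℝ) (Φ : Measure Tcircle) : SkappaC c κ Φ Φ = 0 := by
  refine nonpos_iff_eq_zero.1 ((iInf₂_le Φ Φ).trans ?_)
  simp [otCost_self hcont hc, tvDist_self]

/-- On a compact square, the oscillation of a continuous function is controlled by a continuous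
cost that is positive off the diagonal, up to an arbitrarily small constant. -/
theorem exists_norm_sub_le_add_mul_cost {X : Type*} [TopologicalSpace X] [CompactSpace X]
    {c : X → X → ℝ} (hcont : Continuous fun p : X × X => c p.1 p.2) (hnonneg : ∀ x y, 0 ≤ c x y)
    (hc : ∀ x y, c x y = 0 → x = y) (f : C(X, ℂ)) {δ : ℝ} (hδ : 0 < δ) :
    ∃ C : ℝ, ∀ x y, ‖f x - f y‖ ≤ δ + C * c x y := by
  have hg : Continuous fun p : X × X => ‖f p.1 - f p.2‖ := by fun_prop
  have hK : IsCompact {p : X × X | δ ≤ ‖f p.1 - f p.2‖} :=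
    (isClosed_le continuous_const hg).isCompact
  have hpos : ∀ p ∈ {p : X × X | δ ≤ ‖f p.1 - f p.2‖}, c p.1 p.2 ≠ 0 := by
    intro p hp h0
    have hp' : δ ≤ ‖f p.1 - f p.2‖ := hp
    rw [hc _ _ h0, sub_self, norm_zero] at hp'
    exact absurd hp' (not_le.2 hδ)
  have hq : ContinuousOn (fun p : X × X => ‖f p.1 - f p.2‖ / c p.1 p.2)
      {p : X × X | δ ≤ ‖f p.1 - f p.2‖} := hg.continuousOn.div hcont.continuousOn hpos
  obtain ⟨C, hC⟩ := hK.bddAbove_image hq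
  refine ⟨max C 0, fun x y => ?_⟩
  have hcxy : 0 ≤ max C 0 * c x y := mul_nonneg (le_max_right _ _) (hnonneg x y)
  by_cases h : δ ≤ ‖f x - f y‖
  · have h1 : ‖f x - f y‖ / c x y ≤ C := 
      hC (Set.mem_image_of_mem (fun p : X × X => ‖f p.1 - f p.2‖ / c p.1 p.2)
        (show (x, y) ∈ {p : X × X | δ ≤ ‖f p.1 - f p.2‖} from h))
    have h2 : 0 < c x y := (hnonneg x y).lt_of_ne' (hpos (x, y) h)
    have h3 := (div_le_iff₀ h2).1 (h1.trans (le_max_left C 0))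
    linarith
  · linarith

theorem norm_integral_sub_integral_le_of_otCost_lt {c : Tcircle → Tcircle → ℝ}
    (hcont : Continuous fun p : Tcircle × Tcircle => c p.1 p.2)
    (hnonneg : ∀ θ φ, 0 ≤ c θ φ) (f : C(Tcircle, ℂ)) (hf : ∀ x, ‖f x‖ ≤ 1) {δ C : ℝ}
    (hC : ∀ x y, ‖f x - f y‖ ≤ δ + C * c x y) {Ψ₀ Ψ₁ : Measure Tcircle}
    [IsFiniteMeasure Ψ₀] {η : ℝ} (hη : 0 < η) (hot : otCost c Ψ₀ Ψ₁ < ENNReal.ofReal η) :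
    ‖∫ x, f x ∂Ψ₀ - ∫ x, f x ∂Ψ₁‖ ≤ δ * Ψ₀.real Set.univ + |C| * η := by
  obtain ⟨x, ⟨M, hM₀, hM₁, hx⟩, hM⟩ := sInf_lt_iff.1 hot
  rw [hx] at hM
  have hMmass : M Set.univ = Ψ₀ Set.univ := by
    rw [← hM₀, Measure.map_apply measurable_fst MeasurableSet.univ, Set.preimage_univ]
  have : IsFiniteMeasure M := ⟨hMmass ▸ measure_lt_top _ _⟩
  have hcint : Integrable (fun p : Tcircle × Tcircle => c p.1 p.2) M :=
    ⟨hcont.aestronglyMeasurable, (hasFiniteIntegral_iff_ofReal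
      (Filter.Eventually.of_forall fun p : Tcircle × Tcircle => hnonneg p.1 p.2)).2
      (hM.trans ENNReal.ofReal_lt_top)⟩
  have hcle : ∫ p, c p.1 p.2 ∂M ≤ η := by
    rw [integral_eq_lintegral_of_nonneg_ae
      (Filter.Eventually.of_forall fun p : Tcircle × Tcircle => hnonneg p.1 p.2)
      hcont.aestronglyMeasurable]
    exact ENNReal.toReal_le_of_le_ofReal hη.le hM.le
  have hc0 : 0 ≤ ∫ p, c p.1 p.2 ∂M := integral_nonneg fun p => hnonneg p.1 p.2
  have hf₀ : Continuous fun p : Tcircle × Tcircle => f p.1 := f.continuous.comp continuous_fst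
  have hf₁ : Continuous fun p : Tcircle × Tcircle => f p.2 := f.continuous.comp continuous_snd
  have hi₀ : Integrable (fun p : Tcircle × Tcircle => f p.1) M :=
    Integrable.of_bound hf₀.aestronglyMeasurable 1
      (Filter.Eventually.of_forall fun p : Tcircle × Tcircle => hf _)
  have hi₁ : Integrable (fun p : Tcircle × Tcircle => f p.2) M :=
    Integrable.of_bound hf₁.aestronglyMeasurable 1
      (Filter.Eventually.of_forall fun p : Tcircle × Tcircle => hf _)
  have e₀ : ∫ x, f x ∂Ψ₀ = ∫ p, f p.1 ∂M := by
    rw [← hM₀, integral_map measurable_fst.aemeasurable f.continuous.aestronglyMeasurable]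
  have e₁ : ∫ x, f x ∂Ψ₁ = ∫ p, f p.2 ∂M := by
    rw [← hM₁, integral_map measurable_snd.aemeasurable f.continuous.aestronglyMeasurable]
  rw [e₀, e₁, ← integral_sub hi₀ hi₁]
  calc _ ≤ ∫ p, (δ + C * c p.1 p.2) ∂M :=
        norm_integral_le_of_norm_le ((integrable_const δ).add (hcint.const_mul C))
          (Filter.Eventually.of_forall fun p : Tcircle × Tcircle => hC p.1 p.2)
    _ = δ * Ψ₀.real Set.univ + C * ∫ p, c p.1 p.2 ∂M := by
        rw [integral_add (integrable_const δ) (hcint.const_mul C), integral_const,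
          integral_const_mul, measureReal_def, hMmass, smul_eq_mul, mul_comm, measureReal_def]
    _ ≤ _ := by
        gcongr
        exact le_abs_self C

theorem norm_integral_sub_integral_le_of_SkappaC_lt {c : Tcircle → Tcircle → ℝ} {κ : ℝ}
    (hκ : 0 < κ) (hcont : Continuous fun p : Tcircle × Tcircle => c p.1 p.2)
    (hnonneg : ∀ θ φ, 0 ≤ c θ φ) (f : C(Tcircle, ℂ)) (hf : ∀ x, ‖f x‖ ≤ 1) {δ C : ℝ}
    (hδ : 0 ≤ δ) (hC : ∀ x y, ‖f x - f y‖ ≤ δ + C * c x y) {Φ₀ Φ₁ : Measure Tcircle}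
    [IsFiniteMeasure Φ₀] [IsFiniteMeasure Φ₁] {η : ℝ} (hη : 0 < η)
    (h : SkappaC c κ Φ₀ Φ₁ < ENNReal.ofReal η) :
    ‖∫ x, f x ∂Φ₀ - ∫ x, f x ∂Φ₁‖ ≤ η / κ + δ * (Φ₀.real Set.univ + η / κ) + |C| * η := by
  obtain ⟨Ψ₀, h⟩ := iInf_lt_iff.1 h
  obtain ⟨Ψ₁, h⟩ := iInf_lt_iff.1 h
  have hot : otCost c Ψ₀ Ψ₁ < ENNReal.ofReal η := le_self_add.trans_lt h
  have htv : tvDist Φ₀ Ψ₀ + tvDist Φ₁ Ψ₁ < ENNReal.ofReal (η / κ) := by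
    rw [ENNReal.ofReal_div_of_pos hκ,
      ENNReal.lt_div_iff_mul_lt (Or.inl (ENNReal.ofReal_pos.2 hκ).ne')
        (Or.inl ENNReal.ofReal_ne_top),
      mul_comm]
    exact le_add_self.trans_lt h
  obtain ⟨h₀, h₁⟩ := ENNReal.add_ne_top.1 htv.ne_top
  have := isFiniteMeasure_of_tvDist_ne_top h₀
  have := isFiniteMeasure_of_tvDist_ne_top h₁
  have htv' : (tvDist Φ₀ Ψ₀).toReal + (tvDist Φ₁ Ψ₁).toReal ≤ η / κ := by
    rw [← ENNReal.toReal_add h₀ h₁]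
    exact ENNReal.toReal_le_of_le_ofReal (by positivity) htv.le
  have hd₀ := norm_integral_sub_integral_le_tvDist (μ := Φ₀) (ν := Ψ₀) f hf
  have hd₁ := norm_integral_sub_integral_le_tvDist (μ := Φ₁) (ν := Ψ₁) f hf
  have hmass : Ψ₀.real Set.univ ≤ Φ₀.real Set.univ + η / κ := by
    have := norm_integral_sub_integral_le_tvDist (μ := Φ₀) (ν := Ψ₀) 1 (by simp)
    simp only [ContinuousMap.one_apply, integral_const, Complex.real_smul, mul_one] at this
    rw [← Complex.ofReal_sub, Complex.norm_real, Real.norm_eq_abs] at this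
    have h2 := (abs_le.1 this).1
    have h3 : 0 ≤ (tvDist Φ₁ Ψ₁).toReal := ENNReal.toReal_nonneg
    linarith
  have hdM := norm_integral_sub_integral_le_of_otCost_lt hcont hnonneg f hf hC hη hot
  have hδm := mul_le_mul_of_nonneg_left hmass hδ
  calc _ = ‖(∫ x, f x ∂Φ₀ - ∫ x, f x ∂Ψ₀) + (∫ x, f x ∂Ψ₀ - ∫ x, f x ∂Ψ₁)
          - (∫ x, f x ∂Φ₁ - ∫ x, f x ∂Ψ₁)‖ := by congr 1; ring
    _ ≤ (tvDist Φ₀ Ψ₀).toReal + (δ * Ψ₀.real Set.univ + |C| * η) + (tvDist Φ₁ Ψ₁).toReal :=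
        (norm_sub_le _ _).trans (add_le_add ((norm_add_le _ _).trans (add_le_add hd₀ hdM)) hd₁)
    _ ≤ _ := by linarith

theorem Tkappa_comm (n : ℕ) {c : Tcircle → Tcircle → ℝ} (hc : ∀ θ φ, c θ φ = c φ θ) (κ : ℝ)
    (R₀ R₁ : Matrix (Fin n) (Fin n) ℂ) : Tkappa n c κ R₀ R₁ = Tkappa n c κ R₁ R₀ := by
  unfold Tkappa
  rw [iInf_comm]
  exact iInf_congr fun Φ₁ => iInf_congr fun Φ₀ => SkappaC_comm hc κ _ _

theorem eq_of_Tkappa_eq_zero {n : ℕ} {c : Tcircle → Tcircle → ℝ} {κ : ℝ} (hκ : 0 < κ)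
    (hcont : Continuous fun p : Tcircle × Tcircle => c p.1 p.2)
    (hnonneg : ∀ θ φ, 0 ≤ c θ φ) (hc : ∀ θ φ, c θ φ = 0 → θ = φ)
    {R₀ R₁ : Matrix (Fin n) (Fin n) ℂ} (h : Tkappa n c κ R₀ R₁ = 0) : R₀ = R₁ := by
  have : Fact (0 < 2 * Real.pi) := ⟨Real.two_pi_pos⟩
  ext j k
  let f : C(Tcircle, ℂ) := fourier ((j : ℤ) - (k : ℤ))
  have hf (x) : ‖f x‖ ≤ 1 := by rw [fourier_apply, Circle.norm_coe]
  let a : ℂ := ((1 / (2 * Real.pi) : ℝ) : ℂ)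
  have ha : a ≠ 0 := by
    simp [a, Real.pi_ne_zero]
  let B : ℝ := ‖a⁻¹ * R₀ j j‖
  have hbound (δ : ℝ) (hδ : 0 < δ) : ‖a⁻¹ * (R₀ j k - R₁ j k)‖ ≤ δ * B := by
    obtain ⟨C, hC⟩ := exists_norm_sub_le_add_mul_cost hcont hnonneg hc f hδ
    have hη (η : ℝ) (hη : 0 < η) : ‖a⁻¹ * (R₀ j k - R₁ j k)‖ ≤
        η / κ + δ * (B + η / κ) + |C| * η := by
      have hlt : Tkappa n c κ R₀ R₁ < ENNReal.ofReal η := by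
        rw [h]
        exact ENNReal.ofReal_pos.2 hη
      obtain ⟨⟨Φ₀, hfin₀, rfl⟩, hlt⟩ := iInf_lt_iff.1 hlt
      obtain ⟨⟨Φ₁, hfin₁, rfl⟩, hlt⟩ := iInf_lt_iff.1 hlt
      have hB : Φ₀.real Set.univ = B := by
        change _ = ‖a⁻¹ * (a * ∫ θ, fourier ((j : ℤ) - (j : ℤ)) θ ∂Φ₀)‖
        rw [inv_mul_cancel_left₀ ha]
        simp [abs_of_nonneg measureReal_nonneg]
      rw [← hB]
      convert norm_integral_sub_integral_le_of_SkappaC_lt hκ hcont hnonneg f hf hδ.le hC hη hlt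
        using 2
      change a⁻¹ * (a * _ - a * _) = _
      rw [← mul_sub, inv_mul_cancel_left₀ ha]
    have hcts : Continuous fun η : ℝ => η / κ + δ * (B + η / κ) + |C| * η := by fun_prop
    have hlim := (hcts.tendsto 0).mono_left (nhdsWithin_le_nhds (s := Set.Ioi 0))
    simpa using ge_of_tendsto hlim (eventually_nhdsWithin_of_forall hη)
  have hlim : Filter.Tendsto (fun δ : ℝ => δ * B) (nhdsWithin 0 (Set.Ioi 0)) (nhds 0) := by
    simpa using ((continuous_mul_const B).tendsto 0).mono_left
      (nhdsWithin_le_nhds (s := Set.Ioi 0))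
  have h0 := norm_le_zero_iff.1 (ge_of_tendsto hlim (eventually_nhdsWithin_of_forall hbound))
  exact sub_eq_zero.1 ((mul_eq_zero.1 h0).resolve_left (inv_ne_zero ha))

/-! ### The truncated trigonometric moment problem -/

section Isometry

variable {E : Type*} [NormedAddCommGroup E] [InnerProductSpace ℂ E] 

theorem LinearIsometry.norm_eq_one_of_apply_eq_smul (U : E →ₗᵢ[ℂ] E) {μ : ℂ} {x : E}
    (hx : U x = μ • x) (h0 : x ≠ 0) : ‖μ‖ = 1 := by
  have h := U.norm_map x
  rw [hx, norm_smul] at h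
  exact mul_right_cancel₀ (norm_ne_zero_iff.2 h0) (by rw [h, one_mul])

theorem LinearIsometry.inner_eq_zero_of_apply_eq_smul (U : E →ₗᵢ[ℂ] E) {μ ν : ℂ} (hμν : μ ≠ ν)
    {x y : E} (hx : U x = μ • x) (hy : U y = ν • y) : inner ℂ x y = 0 := by
  by_cases h0 : x = 0
  · rw [h0, inner_zero_left]
  have hμ := U.norm_eq_one_of_apply_eq_smul hx h0
  have h := U.inner_map_map x y
  rw [hx, hy, inner_smul_left, inner_smul_right] at h
  by_contra hne
  have h1 : (starRingEnd ℂ) μ * ν = 1 :=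
    mul_right_cancel₀ hne (by rw [mul_assoc, h, one_mul])
  have h2 : μ * (starRingEnd ℂ) μ = 1 := by
    rw [Complex.mul_conj, Complex.normSq_eq_norm_sq, hμ]
    simp
  exact hμν (by linear_combination ν * h2 - μ * h1)

variable [FiniteDimensional ℂ E]

/-- Two families of vectors with the same Gram matrix are related by an isometry. -/
theorem exists_linearIsometry_of_inner_eq {ι : Type*} [Fintype ι] (f g : ι → E)
    (h : ∀ i j, inner ℂ (f i) (f j) = inner ℂ (g i) (g j)) :
    ∃ U : E →ₗᵢ[ℂ] E, ∀ i, U (f i) = g i := by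
  classical
  let F := Fintype.linearCombination ℂ f
  let G := Fintype.linearCombination ℂ g
  have hnorm (a : ι → ℂ) : ‖G a‖ = ‖F a‖ := by
    have : inner ℂ (G a) (G a) = inner ℂ (F a) (F a) := by
      simp only [F, G, Fintype.linearCombination_apply, sum_inner, inner_sum, inner_smul_left,
        inner_smul_right, h]
    rw [@norm_eq_sqrt_re_inner ℂ, @norm_eq_sqrt_re_inner ℂ, this]
  obtain ⟨s, hs⟩ := F.rangeRestrict.exists_rightInverse_of_surjective F.range_rangeRestrict
  have hFs (y : LinearMap.range F) : F (s y) = y :=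
    congrArg Subtype.val (LinearMap.congr_fun hs y)
  let L : LinearMap.range F →ₗᵢ[ℂ] E := ⟨G ∘ₗ s, fun y => by
    rw [LinearMap.comp_apply, hnorm, hFs, Submodule.coe_norm]⟩
  refine ⟨L.extend, fun i => ?_⟩
  have hFi : F (Pi.single i 1) = f i := by simp [F]
  have hGi : G (Pi.single i 1) = g i := by simp [G]
  let y : LinearMap.range F := ⟨f i, Pi.single i 1, hFi⟩
  change L.extend (y : E) = g i
  rw [LinearIsometry.extend_apply, ← hGi, ← sub_eq_zero]
  change G (s y) - G _ = 0
  rw [← map_sub, ← norm_eq_zero, hnorm, map_sub, hFs, hFi, sub_self, norm_zero]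

/-- The eigenspaces of an isometry of a finite-dimensional complex space span the space. -/
theorem LinearIsometry.iSup_eigenspace_eq_top (U : E →ₗᵢ[ℂ] E) :
    ⨆ μ : ℂ, Module.End.eigenspace U.toLinearMap μ = ⊤ := by
  set S := ⨆ μ : ℂ, Module.End.eigenspace U.toLinearMap μ
  rw [← Submodule.orthogonal_eq_bot_iff]
  have hinv : ∀ y ∈ Sᗮ, U.toLinearMap y ∈ Sᗮ := by
    intro y hy
    rw [← Submodule.iInf_orthogonal, Submodule.mem_iInf] at hy ⊢
    intro μ x hx
    have hx' : U x = μ • x := Module.End.mem_eigenspace_iff.1 hx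
    by_cases h0 : x = 0
    · rw [h0, inner_zero_left]
    have hμ : (starRingEnd ℂ) μ ≠ 0 := by
      intro h
      have := U.norm_eq_one_of_apply_eq_smul hx' h0
      rw [(map_eq_zero _).1 h, norm_zero] at this
      exact zero_ne_one this
    have h := U.inner_map_map x y
    rw [hx', inner_smul_left, hy μ x hx] at h
    exact (mul_eq_zero.1 h).resolve_left hμ
  by_contra hne
  have : Nontrivial Sᗮ := Submodule.nontrivial_iff_ne_bot.2 hne
  obtain ⟨μ, hμ⟩ := Module.End.exists_eigenvalue (U.toLinearMap.restrict hinv)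
  obtain ⟨v, hv⟩ := hμ.exists_hasEigenvector
  have hvS : (v : E) ∈ S := by
    refine Submodule.mem_iSup_of_mem μ (Module.End.mem_eigenspace_iff.2 ?_)
    exact congrArg Subtype.val hv.apply_eq_smul
  exact hv.2 (Subtype.ext (inner_self_eq_zero.1 (v.2 _ hvS)))

/-- The spectral measure of a vector with respect to an isometry of a finite-dimensional complex
space, as a finite combination of point masses on the unit circle. -/
theorem LinearIsometry.exists_inner_pow_eq_sum (U : E →ₗᵢ[ℂ] E) (x : E) :
    ∃ (s : Finset ℂ) (w : ℂ → ℝ) (z : ℂ → Circle), (∀ μ, 0 ≤ w μ) ∧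
      ∀ j k : ℕ, inner ℂ ((U.toLinearMap ^ j) x) ((U.toLinearMap ^ k) x) =
        ∑ μ ∈ s, (w μ : ℂ) * ((z μ ^ ((j : ℤ) - (k : ℤ)) : Circle) : ℂ) := by
  have hx : x ∈ ⨆ μ : ℂ, Module.End.eigenspace U.toLinearMap μ := by
    rw [U.iSup_eigenspace_eq_top]
    trivial
  obtain ⟨v, hv, hsum⟩ := (Submodule.mem_iSup_iff_exists_finsupp _ _).1 hx
  have hv' (μ : ℂ) : U (v μ) = μ • v μ := Module.End.mem_eigenspace_iff.1 (hv μ)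
  have hpow (j : ℕ) (μ : ℂ) : (U.toLinearMap ^ j) (v μ) = μ ^ j • v μ := by
    induction j with
    | zero => simp
    | succ j ih =>
      rw [pow_succ', Module.End.mul_apply, ih, map_smul, LinearIsometry.coe_toLinearMap, hv',
        smul_smul, pow_succ]
  have hz (μ : ℂ) : ∃ z : Circle, v μ ≠ 0 → (z : ℂ) = (starRingEnd ℂ) μ := by
    by_cases h0 : v μ = 0
    · exact ⟨1, fun h => absurd h0 h⟩
    · refine ⟨⟨(starRingEnd ℂ) μ, ?_⟩, fun _ => rfl⟩
      refine mem_sphere_zero_iff_norm.2 ((RCLike.norm_conj μ).trans ?_)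
      exact U.norm_eq_one_of_apply_eq_smul (hv' μ) h0
  choose z hz using hz
  refine ⟨v.support, fun μ => ‖v μ‖ ^ 2, z, fun μ => sq_nonneg _, fun j k => ?_⟩
  rw [← hsum, Finsupp.sum, map_sum, map_sum, sum_inner]
  refine Finset.sum_congr rfl fun μ hμ => ?_
  have h0 : v μ ≠ 0 := Finsupp.mem_support_iff.1 hμ
  rw [inner_sum, Finset.sum_eq_single μ]
  · rw [hpow, hpow, inner_smul_left, inner_smul_right, inner_self_eq_norm_sq_to_K, _root_.zpow_sub,
      Circle.coe_mul, Circle.coe_inv_eq_conj, zpow_natCast, zpow_natCast, Circle.coe_pow,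
      Circle.coe_pow, hz μ h0, map_pow, map_pow, Complex.conj_conj]
    rw [RCLike.ofReal_eq_complex_ofReal, Complex.ofReal_pow]
    ring
  · intro ν _ hν
    rw [hpow, hpow, inner_smul_left, inner_smul_right,
      U.inner_eq_zero_of_apply_eq_smul hν.symm (hv' μ) (hv' ν), mul_zero, mul_zero]
  · exact fun h => absurd hμ h

end Isometry

theorem Matrix.PosSemidef.exists_eq_gram {n : Type*} [Finite n] {R : Matrix n n ℂ}
    (hR : R.PosSemidef) :
    ∃ (m : ℕ) (e : n → EuclideanSpace ℂ (Fin m)), R = Matrix.gram ℂ e := by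
  obtain ⟨m, v, rfl⟩ := Matrix.posSemidef_iff_eq_sum_vecMulVec.1 hR
  refine ⟨m, fun j => WithLp.toLp 2 fun i => star (v i j), ?_⟩
  ext j k
  simp [Matrix.gram_apply, Matrix.sum_apply, Matrix.vecMulVec_apply, PiLp.inner_apply, mul_comm]

/-- Every positive semidefinite Toeplitz matrix is the covariance of some non-negative measure. -/
theorem exists_GammaC_eq {n : ℕ} {R : Matrix (Fin n) (Fin n) ℂ} (hR : R.PosSemidef)
    (hT : IsToeplitz R) : ∃ Φ : Measure Tcircle, IsFiniteMeasure Φ ∧ GammaC n Φ = R := by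
  cases n with
  | zero => exact ⟨0, inferInstance, by ext j; exact j.elim0⟩
  | succ n =>
    obtain ⟨m, e, rfl⟩ := hR.exists_eq_gram
    obtain ⟨U, hU⟩ := exists_linearIsometry_of_inner_eq (fun i : Fin n => e i.castSucc)
      (fun i => e i.succ) (fun i j => hT _ _ _ _ (by simp))
    have he (j : Fin (n + 1)) : e j = (U.toLinearMap ^ (j : ℕ)) (e 0) := by
      induction j using Fin.induction with
      | zero => simp
      | succ j ih =>
        rw [← hU, ih, Fin.val_succ, pow_succ']
        rfl
    obtain ⟨s, w, z, hw, hs⟩ := U.exists_inner_pow_eq_sum (e 0)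
    have hθ (μ : ℂ) : ∃ θ : Tcircle, θ.toCircle = z μ :=
      ⟨(AddCircle.homeomorphCircle Real.two_pi_pos.ne').symm (z μ), by
        rw [← AddCircle.homeomorphCircle_apply Real.two_pi_pos.ne', Homeomorph.apply_symm_apply]⟩
    choose θ hθ using hθ
    refine ⟨∑ μ ∈ s, ENNReal.ofReal (2 * Real.pi * w μ) • Measure.dirac (θ μ), ?_, ?_⟩
    · refine ⟨?_⟩
      simp
    · ext j k
      rw [Matrix.gram_apply, he j, he k, hs, GammaC, Matrix.of_apply,
        integral_finsetSum_measure, Finset.mul_sum]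
      · refine Finset.sum_congr rfl fun μ _ => ?_
        rw [integral_smul_measure, integral_dirac, fourier_apply, AddCircle.toCircle_zsmul, hθ,
          ENNReal.toReal_ofReal (mul_nonneg Real.two_pi_pos.le (hw μ)), Complex.real_smul]
        have := Real.pi_ne_zero
        push_cast
        field_simp
      · intro μ _
        exact (integrable_dirac (by simp)).smul_measure ENNReal.ofReal_ne_top

theorem Tkappa_self {n : ℕ} {c : Tcircle → Tcircle → ℝ}
    (hcont : Continuous fun p : Tcircle × Tcircle => c p.1 p.2) (hc : ∀ θ, c θ θ = 0) (κ : ℝ)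
    {R : Matrix (Fin n) (Fin n) ℂ} (hR : R.PosSemidef) (hT : IsToeplitz R) :
    Tkappa n c κ R R = 0 := by
  obtain ⟨Φ, hΦ⟩ := exists_GammaC_eq hR hT
  have h : Tkappa n c κ R R ≤ SkappaC c κ Φ Φ :=
    iInf_le_of_le ⟨Φ, hΦ⟩ (iInf_le_of_le ⟨Φ, hΦ⟩ le_rfl)
  rwa [SkappaC_self hcont hc, nonpos_iff_eq_zero] at h

/-- for `κ > 0` and a continuous semi-metric cost `c`, `T_κ` is a semi-metric
on the positive semi-definite Toeplitz matrices. -/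
theorem Tkappa_is_semimetric (n : ℕ) (c : Tcircle → Tcircle → ℝ) (κ : ℝ) (hκ : 0 < κ)
    (hc_cont : Continuous fun p : Tcircle × Tcircle => c p.1 p.2)
    (hc_nonneg : ∀ θ φ, 0 ≤ c θ φ)
    (hc_eq : ∀ θ φ, c θ φ = 0 ↔ θ = φ)
    (hc_symm : ∀ θ φ, c θ φ = c φ θ) :
    (∀ R₀ R₁ : Matrix (Fin n) (Fin n) ℂ, 0 ≤ Tkappa n c κ R₀ R₁) ∧
    (∀ R₀ R₁ : Matrix (Fin n) (Fin n) ℂ, Tkappa n c κ R₀ R₁ = Tkappa n c κ R₁ R₀) ∧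
    (∀ R₀ R₁ : Matrix (Fin n) (Fin n) ℂ,
      R₀.PosSemidef → IsToeplitz R₀ → R₁.PosSemidef → IsToeplitz R₁ →
      (Tkappa n c κ R₀ R₁ = 0 ↔ R₀ = R₁)) := by
  refine ⟨fun _ _ => zero_le, Tkappa_comm n hc_symm κ, fun R₀ R₁ hR₀ hT₀ _ _ =>
    ⟨eq_of_Tkappa_eq_zero hκ hc_cont hc_nonneg fun θ φ => (hc_eq θ φ).1, ?_⟩⟩
  rintro rfl
  exact Tkappa_self hc_cont (fun θ => (hc_eq θ θ).2 rfl) κ hR₀ hT₀
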